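/- arXiv:math/0409202 — 3 statements merged into one kernel-verified Lean document; each statement's English description precedes it below -/
import Mathlib

section
/- Let Q be a rack, A a commutative ring, n ≥ 1, and f: AQ^n → AQ^n an A-linear map. Then d_i f = 0 for every i = 0,…,n (i.e., f is entropic in the sense of the graphical definition) if and only if f is both quasi-diagonal and fully equivariant. -/
open TensorProduct

noncomputable section

/-- A rack: a set with a binary operation `act x y = x ^ y` such that all right
translations are bijective and the operation is right self-distributive. -/
structure YBRack (Q : Type*) where
  act : Q → Q → Q
  act_bijective : ∀ y : Q, Function.Bijective fun x => act x y
  self_distrib : ∀ x y z : Q, act (act x y) z = act (act x z) (act y z)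

namespace YBRack

variable {Q : Type*} {A : Type*} [CommRing A]

/-- Right translation by `y` as a permutation of `Q`. -/
def rho (R : YBRack Q) (y : Q) : Equiv.Perm Q :=
  Equiv.ofBijective _ (R.act_bijective y)

/-- The inner automorphism group of a rack: the subgroup of `Perm Q` generated
by all right translations. -/
def Inn (R : YBRack Q) : Subgroup (Equiv.Perm Q) :=
  Subgroup.closure (Set.range R.rho)

/-- Behavioural equivalence: `x ≡ y` iff `ϱ(x) = ϱ(y)`. -/
def BEquiv (R : YBRack Q) (x y : Q) : Prop := R.rho x = R.rho y

end YBRack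
namespace YBRack

variable {Q : Type*} {A : Type*} [CommRing A]

/-- Iterated rack action by the elements of a list: `x ^ (z₁ z₂ ⋯ z_k)`. -/
def actList (R : YBRack Q) (x : Q) (l : List Q) : Q := l.foldl R.act x

open scoped Classical in
/-- The `i`-th partial coboundary operator `d_i` on matrices of `n`-cochains
(indices `0, …, n` correspond to the paper's `x_0, …, x_n`). -/
def dPart (R : YBRack Q) {n : ℕ} (f : (Fin n → Q) → (Fin n → Q) → A) (i : Fin (n+1))
    (x y : Fin (n+1) → Q) : A :=
  f (fun j => x (i.succAbove j)) (fun j => y (i.succAbove j)) *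
      (if R.actList (x i) ((List.ofFn x).drop ((i : ℕ)+1))
          = R.actList (y i) ((List.ofFn y).drop ((i : ℕ)+1)) then 1 else 0)
  - f (fun j => if (j : ℕ) < (i : ℕ) then R.act (x (i.succAbove j)) (x i) else x (i.succAbove j))
      (fun j => if (j : ℕ) < (i : ℕ) then R.act (y (i.succAbove j)) (y i) else y (i.succAbove j)) *
      (if x i = y i then 1 else 0)

/-- The full coboundary operator `d = Σ_{i=0}^{n} (-1)^i d_i`. -/
def dSum (R : YBRack Q) {n : ℕ} (f : (Fin n → Q) → (Fin n → Q) → A)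
    (x y : Fin (n+1) → Q) : A :=
  ∑ i : Fin (n+1), (-1 : A) ^ (i : ℕ) * R.dPart f i x y

/-- A matrix is quasi-diagonal if its entry vanishes as soon as some pair of
indices is not behaviourally equivalent. -/
def QuasiDiagonal (R : YBRack Q) {n : ℕ} (f : (Fin n → Q) → (Fin n → Q) → A) : Prop :=
  ∀ x y : Fin n → Q, (∃ i : Fin n, ¬ R.BEquiv (x i) (y i)) → f x y = 0

/-- A matrix is fully equivariant if it is invariant under the coordinatewise
action of `Inn(Q)^n`. -/
def FullyEquivariant (R : YBRack Q) {n : ℕ} (f : (Fin n → Q) → (Fin n → Q) → A) : Prop :=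
  ∀ (x y : Fin n → Q) (α : Fin n → R.Inn),
    f (fun i => (α i : Equiv.Perm Q) (x i)) (fun i => (α i : Equiv.Perm Q) (y i)) = f x y

end YBRack

namespace YBRack

variable {Q A : Type*}

/-- The translation by `a` on the coordinates below `k`, the identity on the others. -/
def prefixHom (Q : Type*) {n : ℕ} (k : ℕ) : Equiv.Perm Q →* (Fin n → Equiv.Perm Q) where
  toFun g j := if (j : ℕ) < k then g else 1
  map_one' := by ext; simp
  map_mul' g h := by
    funext j
    by_cases hj : (j : ℕ) < k <;> simp [hj]

/-- The coordinatewise permutations of the indices that leave a matrix invariant. -/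
def invariance {n : ℕ} (f : (Fin n → Q) → (Fin n → Q) → A) :
    Subgroup (Fin n → Equiv.Perm Q) where
  carrier := {σ | ∀ x y, f (fun j => σ j (x j)) (fun j => σ j (y j)) = f x y}
  one_mem' _ _ := rfl
  mul_mem' {σ τ} hσ hτ x y :=
    (hσ (fun j => τ j (x j)) (fun j => τ j (y j))).trans (hτ x y)
  inv_mem' {σ} hσ x y := by
    simpa using (hσ (fun j => (σ j)⁻¹ (x j)) (fun j => (σ j)⁻¹ (y j))).symm

theorem mem_invariance {n : ℕ} {f : (Fin n → Q) → (Fin n → Q) → A}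
    {σ : Fin n → Equiv.Perm Q} :
    σ ∈ invariance f ↔ ∀ x y, f (fun j => σ j (x j)) (fun j => σ j (y j)) = f x y :=
  Iff.rfl

theorem rho_mem_Inn (R : YBRack Q) (a : Q) : R.rho a ∈ R.Inn :=
  Subgroup.subset_closure ⟨a, rfl⟩

theorem fullyEquivariant_of_prefixHom_mem (R : YBRack Q) {n : ℕ}
    {f : (Fin n → Q) → (Fin n → Q) → A}
    (h : ∀ k ≤ n, ∀ a, prefixHom Q k (R.rho a) ∈ invariance f) :
    R.FullyEquivariant f := by
  have hInn : ∀ k ≤ n, ∀ g ∈ R.Inn, prefixHom Q k g ∈ invariance f := by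
    intro k hk
    change R.Inn ≤ (invariance f).comap (prefixHom Q k)
    rw [Inn, Subgroup.closure_le]
    rintro _ ⟨a, rfl⟩
    exact h k hk a
  intro x y α
  refine mem_invariance.1 (Subgroup.pi_mem_of_mulSingle_mem
    (fun i => (α i : Equiv.Perm Q)) fun i => ?_) x y
  have hs : Pi.mulSingle i (α i : Equiv.Perm Q) =
      prefixHom Q ((i : ℕ) + 1) (α i : Equiv.Perm Q) *
        (prefixHom Q (i : ℕ) (α i : Equiv.Perm Q))⁻¹ := by
    funext j
    rcases lt_trichotomy j i with hj | rfl | hj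
    · simp [prefixHom, hj.ne, hj, hj.le]
    · simp [prefixHom]
    · simp [prefixHom, hj.ne', hj.not_ge, hj.not_gt]
  rw [hs]
  exact mul_mem (hInn _ i.isLt _ (α i).2) (inv_mem (hInn _ i.isLt.le _ (α i).2))

theorem actList_bijective (R : YBRack Q) (l : List Q) :
    Function.Bijective fun a => R.actList a l := by
  induction l with
  | nil => exact Function.bijective_id
  | cons b l ih => exact ih.comp (R.act_bijective b)

theorem actList_congr (R : YBRack Q) {l m : List Q} (h : List.Forall₂ R.BEquiv l m) (a : Q) :
    R.actList a l = R.actList a m := by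
  induction h generalizing a with
  | nil => rfl
  | @cons b c l m hbc _ ih =>
    have : R.act a b = R.act a c := DFunLike.congr_fun hbc a
    simp only [actList, List.foldl_cons, this]
    exact ih _

theorem BEquiv.act_iff (R : YBRack Q) (x y a : Q) :
    R.BEquiv (R.act x a) (R.act y a) ↔ R.BEquiv x y := by
  simp only [BEquiv, Equiv.ext_iff]
  change (∀ z, R.act z (R.act x a) = R.act z (R.act y a)) ↔ ∀ z, R.act z x = R.act z y
  rw [(R.act_bijective a).surjective.forall]
  simp only [← R.self_distrib]
  exact forall_congr' fun z => (R.act_bijective a).injective.eq_iff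

theorem drop_succ_ofFn {n : ℕ} (i : Fin (n + 1)) (x : Fin (n + 1) → Q) :
    (List.ofFn x).drop ((i : ℕ) + 1) = (List.ofFn fun j => x (i.succAbove j)).drop i := by
  refine List.ext_getElem (by simp) fun k h₁ h₂ => ?_
  simp only [List.getElem_drop, List.getElem_ofFn]
  congr 1
  rw [Fin.succAbove_of_le_castSucc]
  · ext; simp; omega
  · simp [Fin.le_def]

theorem drop_ofFn {n : ℕ} (i : Fin n) (x : Fin n → Q) :
    (List.ofFn x).drop i = x i :: (List.ofFn x).drop ((i : ℕ) + 1) := by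
  rw [List.drop_eq_getElem_cons (by simp)]
  simp

open scoped Classical in
theorem dPart_eq [CommRing A] (R : YBRack Q) {n : ℕ} (f : (Fin n → Q) → (Fin n → Q) → A)
    (i : Fin (n + 1)) (x y : Fin (n + 1) → Q) :
    R.dPart f i x y =
      f (i.removeNth x) (i.removeNth y) *
        (if R.actList (x i) ((List.ofFn (i.removeNth x)).drop i) =
            R.actList (y i) ((List.ofFn (i.removeNth y)).drop i) then 1 else 0) -
      f (fun j => prefixHom Q i (R.rho (x i)) j (i.removeNth x j))
          (fun j => prefixHom Q i (R.rho (y i)) j (i.removeNth y j)) *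
        (if x i = y i then 1 else 0) := by
  have (z : Fin (n + 1) → Q) :
      (fun j : Fin n => prefixHom Q i (R.rho (z i)) j (i.removeNth z j)) =
        fun j : Fin n => if (j : ℕ) < (i : ℕ) then R.act (z (i.succAbove j)) (z i)
          else z (i.succAbove j) := by
    funext j
    by_cases hj : (j : ℕ) < i <;> simp [prefixHom, hj, rho, Fin.removeNth]
  rw [this, this, dPart, drop_succ_ofFn, drop_succ_ofFn]
  rfl

theorem forall₂_drop_ofFn (R : YBRack Q) {n : ℕ} {x y : Fin n → Q}
    (h : ∀ j, R.BEquiv (x j) (y j)) (k : ℕ) :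
    List.Forall₂ R.BEquiv ((List.ofFn x).drop k) ((List.ofFn y).drop k) := by
  refine List.forall₂_iff_get.2 ⟨by simp, fun j _ _ => ?_⟩
  simpa using h _

theorem actList_drop_eq_of_dPart_eq_zero [CommRing A] (R : YBRack Q) {n : ℕ}
    {f : (Fin n → Q) → (Fin n → Q) → A} {i : Fin (n + 1)}
    (h : ∀ x y, R.dPart f i x y = 0) {x y : Fin n → Q} (hf : f x y ≠ 0) (a : Q) :
    R.actList a ((List.ofFn x).drop i) = R.actList a ((List.ofFn y).drop i) := by
  obtain ⟨b, hb⟩ := (R.actList_bijective ((List.ofFn y).drop i)).surjective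
    (R.actList a ((List.ofFn x).drop i))
  have hab : a = b := by
    by_contra hab
    have := h (i.insertNth a x) (i.insertNth b y)
    rw [dPart_eq, Fin.removeNth_insertNth, Fin.removeNth_insertNth, Fin.insertNth_apply_same,
      Fin.insertNth_apply_same] at this
    rw [if_pos hb.symm, if_neg hab] at this
    simp [hf] at this
  subst hab
  exact hb.symm

theorem quasiDiagonal_of_dPart_eq_zero [CommRing A] (R : YBRack Q) {n : ℕ}
    {f : (Fin n → Q) → (Fin n → Q) → A} (h : ∀ i x y, R.dPart f i x y = 0) :
    R.QuasiDiagonal f := by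
  rintro x y ⟨i, hi⟩
  by_contra hf
  refine hi (Equiv.ext fun a => ?_)
  have h₁ := R.actList_drop_eq_of_dPart_eq_zero (h i.castSucc) hf a
  have h₂ := R.actList_drop_eq_of_dPart_eq_zero (h i.succ) hf (R.act a (x i))
  simp only [Fin.val_castSucc, Fin.val_succ, drop_ofFn] at h₁ h₂
  exact (R.actList_bijective _).injective (h₂.symm.trans h₁)

theorem fullyEquivariant_of_dPart_eq_zero [CommRing A] (R : YBRack Q) {n : ℕ}
    {f : (Fin n → Q) → (Fin n → Q) → A} (h : ∀ i x y, R.dPart f i x y = 0) :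
    R.FullyEquivariant f := by
  refine R.fullyEquivariant_of_prefixHom_mem fun k hk a x y => ?_
  by_cases hxy : ∀ j, R.BEquiv (x j) (y j)
  · have := h ⟨k, Nat.lt_succ_of_le hk⟩ (Fin.insertNth ⟨k, Nat.lt_succ_of_le hk⟩ a x)
      (Fin.insertNth ⟨k, Nat.lt_succ_of_le hk⟩ a y)
    rw [dPart_eq, Fin.removeNth_insertNth, Fin.removeNth_insertNth, Fin.insertNth_apply_same,
      Fin.insertNth_apply_same] at this
    rw [if_pos (R.actList_congr (R.forall₂_drop_ofFn hxy k) a), if_pos rfl, mul_one, mul_one,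
      sub_eq_zero] at this
    exact this.symm
  · push Not at hxy
    obtain ⟨j, hj⟩ := hxy
    have hq := R.quasiDiagonal_of_dPart_eq_zero h
    rw [hq x y ⟨j, hj⟩]
    refine hq _ _ ⟨j, ?_⟩
    by_cases hjk : (j : ℕ) < k
    · simpa [prefixHom, hjk, rho, BEquiv.act_iff] using hj
    · simpa [prefixHom, hjk] using hj

theorem dPart_eq_zero [CommRing A] (R : YBRack Q) {n : ℕ}
    {f : (Fin n → Q) → (Fin n → Q) → A} (hq : R.QuasiDiagonal f) (he : R.FullyEquivariant f)
    (i : Fin (n + 1)) (x y : Fin (n + 1) → Q) : R.dPart f i x y = 0 := by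
  have hinv (a : Q) (u v : Fin n → Q) :
      f (fun j => prefixHom Q i (R.rho a) j (u j)) (fun j => prefixHom Q i (R.rho a) j (v j)) =
        f u v := by
    refine he u v fun j => ⟨prefixHom Q i (R.rho a) j, ?_⟩
    by_cases hj : (j : ℕ) < i <;> simp [prefixHom, hj, rho_mem_Inn, one_mem]
  rw [dPart_eq]
  by_cases hxy : ∀ j, R.BEquiv (i.removeNth x j) (i.removeNth y j)
  · rw [R.actList_congr (R.forall₂_drop_ofFn hxy i)]
    by_cases h : x i = y i
    · simp [h, hinv]
    · rw [if_neg h, if_neg ((R.actList_bijective _).injective.ne h)]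
      simp
  · push Not at hxy
    by_cases h : x i = y i
    · simp [h, hinv, hq _ _ hxy]
    · simp [h, hq _ _ hxy]

end YBRack

/-- An `A`-linear map `f : AQ^n → AQ^n` (given by its matrix)
satisfies `d_i f = 0` for all `i = 0, …, n` (i.e. is entropic) if and only if
it is quasi-diagonal and fully equivariant. -/
theorem entropic_iff_quasiDiagonal_and_fullyEquivariant
    {A Q : Type*} [CommRing A] (R : YBRack Q) {n : ℕ} (hn : 1 ≤ n)
    (f : (Fin n → Q) → (Fin n → Q) → A) :
    (∀ (i : Fin (n+1)) (x y : Fin (n+1) → Q), R.dPart f i x y = 0) ↔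
      (R.QuasiDiagonal f ∧ R.FullyEquivariant f) := by
  exact ⟨fun h => ⟨R.quasiDiagonal_of_dPart_eq_zero h, R.fullyEquivariant_of_dPart_eq_zero h⟩,
    fun h => R.dPart_eq_zero h.1 h.2⟩

end
end

section
/- Let Q be a rack, A a commutative ring, and f an entropic A-linear automorphism of AQ². Let τ: AQ² → AQ² be the transposition operator τ(x ⊗ y) = y ⊗ x. Then c_Q ∘ f satisfies the Yang-Baxter equation if and only if τ ∘ f satisfies the Yang-Baxter equation (that is, if and only if f is an r-matrix). -/
open TensorProduct

noncomputable section

/-- Matrix of a linear endomorphism of `AQ ⊗ AQ`, via the identification of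
`AQ ⊗ AQ` with the free module on `Q × Q`. -/
def mat2 (A : Type*) [CommRing A] {Q : Type*}
    (f : ((Q →₀ A) ⊗[A] (Q →₀ A)) →ₗ[A] ((Q →₀ A) ⊗[A] (Q →₀ A))) (p q : Q × Q) : A :=
  finsuppTensorFinsupp' A Q Q (f ((finsuppTensorFinsupp' A Q Q).symm (Finsupp.single p 1))) q

/-- Matrix of a linear endomorphism of `AQ`. -/
def mat1 (A : Type*) [CommRing A] {Q : Type*}
    (f : (Q →₀ A) →ₗ[A] (Q →₀ A)) (x u : Q) : A :=
  f (Finsupp.single x 1) u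

/-- The Yang–Baxter (braid) equation for an endomorphism of `M ⊗ M`, where
`c₁ = c ⊗ id` and `c₂ = id ⊗ c` act on `(M ⊗ M) ⊗ M`. -/
def YBE {A M : Type*} [CommRing A] [AddCommGroup M] [Module A M]
    (c : (M ⊗[A] M) →ₗ[A] (M ⊗[A] M)) : Prop :=
  (LinearMap.rTensor M c) ∘ₗ
      ((TensorProduct.assoc A M M M).symm.toLinearMap ∘ₗ (LinearMap.lTensor M c) ∘ₗ
        (TensorProduct.assoc A M M M).toLinearMap) ∘ₗ (LinearMap.rTensor M c)
    = ((TensorProduct.assoc A M M M).symm.toLinearMap ∘ₗ (LinearMap.lTensor M c) ∘ₗ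
        (TensorProduct.assoc A M M M).toLinearMap) ∘ₗ (LinearMap.rTensor M c) ∘ₗ
      ((TensorProduct.assoc A M M M).symm.toLinearMap ∘ₗ (LinearMap.lTensor M c) ∘ₗ
        (TensorProduct.assoc A M M M).toLinearMap)

/-- A Yang–Baxter operator: a bijective linear endomorphism of `M ⊗ M`
satisfying the Yang–Baxter equation. -/
def IsYBOp {A M : Type*} [CommRing A] [AddCommGroup M] [Module A M]
    (c : (M ⊗[A] M) →ₗ[A] (M ⊗[A] M)) : Prop :=
  Function.Bijective c ∧ YBE c

/-- An endomorphism of `AQ ⊗ AQ` is entropic (with respect to the rack `R`)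
if its matrix is quasi-diagonal and fully equivariant. -/
def Entropic2 {Q : Type*} (R : YBRack Q) (A : Type*) [CommRing A]
    (f : ((Q →₀ A) ⊗[A] (Q →₀ A)) →ₗ[A] ((Q →₀ A) ⊗[A] (Q →₀ A))) : Prop :=
  (∀ x y u v : Q, (¬ R.BEquiv x u ∨ ¬ R.BEquiv y v) → mat2 A f (x, y) (u, v) = 0) ∧
  (∀ (x y u v : Q) (α β : R.Inn),
    mat2 A f ((α : Equiv.Perm Q) x, (β : Equiv.Perm Q) y)
        ((α : Equiv.Perm Q) u, (β : Equiv.Perm Q) v)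
      = mat2 A f (x, y) (u, v))

open scoped Classical in
/-- Two Yang–Baxter operators are equivalent with respect to the ideal `m` if
they are conjugate by `α ⊗ α` for some automorphism `α` of `AQ` congruent to
the identity modulo `m`. -/
def YBEquivalent {Q A : Type*} [CommRing A] (m : Ideal A)
    (c c' : ((Q →₀ A) ⊗[A] (Q →₀ A)) →ₗ[A] ((Q →₀ A) ⊗[A] (Q →₀ A))) : Prop :=
  ∃ α : (Q →₀ A) ≃ₗ[A] (Q →₀ A),
    (∀ x u : Q, (α (Finsupp.single x 1)) u - (if x = u then 1 else 0) ∈ m) ∧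
    c' = (TensorProduct.congr α α).toLinearMap ∘ₗ c ∘ₗ (TensorProduct.congr α α).symm.toLinearMap

section Entropic

variable {A Q : Type*} [CommRing A]

namespace YBRack

/-- The operator `c_Q` of a rack has a linear left inverse. -/
theorem braiding_hasLeftInverse (R : YBRack Q)
    (c : ((Q →₀ A) ⊗[A] (Q →₀ A)) →ₗ[A] ((Q →₀ A) ⊗[A] (Q →₀ A)))
    (hc : ∀ x y : Q, c (Finsupp.single x (1 : A) ⊗ₜ[A] Finsupp.single y (1 : A))
      = Finsupp.single y (1 : A) ⊗ₜ[A] Finsupp.single (R.act x y) (1 : A)) :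
    ∃ d : ((Q →₀ A) ⊗[A] (Q →₀ A)) →ₗ[A] ((Q →₀ A) ⊗[A] (Q →₀ A)), d ∘ₗ c = LinearMap.id := by
  let d₀ : (Q →₀ A) →ₗ[A] (Q →₀ A) →ₗ[A] ((Q →₀ A) ⊗[A] (Q →₀ A)) :=
    Finsupp.lift _ A Q fun y => Finsupp.lift _ A Q fun w =>
      Finsupp.single ((R.rho y).symm w) (1 : A) ⊗ₜ[A] Finsupp.single y (1 : A)
  refine ⟨TensorProduct.lift d₀, ?_⟩
  ext x y : 5
  have h : (R.rho y).symm (R.act x y) = x := (R.rho y).symm_apply_apply x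
  simp [hc, d₀, h]

/-- The trivial rack, whose braiding is the transposition. -/
def trivial (Q : Type*) : YBRack Q where
  act x _ := x
  act_bijective _ := Function.bijective_id
  self_distrib _ _ _ := rfl

theorem rho_trivial (y : Q) : (trivial Q).rho y = 1 := by
  ext x
  rfl

theorem coe_inn_trivial (α : (trivial Q).Inn) : (α : Equiv.Perm Q) = 1 := by
  have h : (trivial Q).Inn = ⊥ := by
    rw [Inn, Subgroup.closure_eq_bot_iff]
    rintro _ ⟨y, rfl⟩
    exact rho_trivial y
  exact Subgroup.mem_bot.1 (h ▸ α.2)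

theorem rho_mem_inn (R : YBRack Q) (y : Q) : R.rho y ∈ R.Inn :=
  Subgroup.subset_closure ⟨y, rfl⟩

end YBRack

theorem entropic2_trivial
    (f : ((Q →₀ A) ⊗[A] (Q →₀ A)) →ₗ[A] ((Q →₀ A) ⊗[A] (Q →₀ A))) :
    Entropic2 (YBRack.trivial Q) A f := by
  refine ⟨fun x y u v h => ?_, fun x y u v α β => ?_⟩
  · simp [YBRack.BEquiv, YBRack.rho_trivial] at h
  · simp [YBRack.coe_inn_trivial]

/-- Full equivariance and quasi-diagonality of an entropic `f`, as a comparison principle for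
linear maps out of `AQ ⊗ AQ`. -/
theorem Entropic2.map_apply_eq {R : YBRack Q}
    {f : ((Q →₀ A) ⊗[A] (Q →₀ A)) →ₗ[A] ((Q →₀ A) ⊗[A] (Q →₀ A))} (hf : Entropic2 R A f)
    {N : Type*} [AddCommMonoid N] [Module A N] (L L' : ((Q →₀ A) ⊗[A] (Q →₀ A)) →ₗ[A] N)
    {α β : Equiv.Perm Q} (hα : α ∈ R.Inn) (hβ : β ∈ R.Inn) (x y : Q)
    (h : ∀ u v, R.BEquiv x u → R.BEquiv y v →
      L (Finsupp.single (α u) (1 : A) ⊗ₜ[A] Finsupp.single (β v) (1 : A))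
        = L' (Finsupp.single u (1 : A) ⊗ₜ[A] Finsupp.single v (1 : A))) :
    L (f (Finsupp.single (α x) (1 : A) ⊗ₜ[A] Finsupp.single (β y) (1 : A)))
      = L' (f (Finsupp.single x (1 : A) ⊗ₜ[A] Finsupp.single y (1 : A))) := by
  let e := finsuppTensorFinsupp' A Q Q
  have he (a b : Q) : e.symm (Finsupp.single (a, b) 1)
      = Finsupp.single a (1 : A) ⊗ₜ[A] Finsupp.single b (1 : A) := by
    rw [LinearEquiv.symm_apply_eq]
    simp [e]
  set g := e (f (Finsupp.single x (1 : A) ⊗ₜ[A] Finsupp.single y (1 : A))) with hg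
  set g' := e (f (Finsupp.single (α x) (1 : A) ⊗ₜ[A] Finsupp.single (β y) (1 : A))) with hg'
  have hm (a b : Q) (q : Q × Q) : mat2 A f (a, b) q
      = e (f (Finsupp.single a (1 : A) ⊗ₜ[A] Finsupp.single b (1 : A))) q := by
    rw [← he]
    rfl
  have hgg : g' = g.mapDomain (α.prodCongr β) := by
    ext q
    obtain ⟨⟨u, v⟩, rfl⟩ := (α.prodCongr β).surjective q
    rw [Finsupp.mapDomain_apply (α.prodCongr β).injective]
    have := hf.2 x y u v ⟨α, hα⟩ ⟨β, hβ⟩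
    rw [hm, hm] at this
    exact this
  have hL (K : ((Q →₀ A) ⊗[A] (Q →₀ A)) →ₗ[A] N) (k : Q × Q →₀ A) : K (e.symm k)
      = k.sum fun p a => a • K (Finsupp.single p.1 (1 : A) ⊗ₜ[A] Finsupp.single p.2 (1 : A)) := by
    conv_lhs => rw [← Finsupp.sum_single k]
    simp only [Finsupp.sum, map_sum]
    refine Finset.sum_congr rfl fun p _ => ?_
    rw [← he, ← map_smul, ← map_smul, Finsupp.smul_single_one]
  rw [← e.symm_apply_apply (f (Finsupp.single (α x) (1 : A) ⊗ₜ[A] _)), ← hg',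
    ← e.symm_apply_apply (f (Finsupp.single x (1 : A) ⊗ₜ[A] _)), ← hg, hL, hL, hgg,
    Finsupp.sum_mapDomain_index (by simp) (by simp [add_smul])]
  refine Finset.sum_congr rfl fun ⟨u, v⟩ hp => ?_
  have hne : mat2 A f (x, y) (u, v) ≠ 0 := by
    rw [hm]
    exact Finsupp.mem_support_iff.1 hp
  have huv := mt (hf.1 x y u v) hne
  push Not at huv
  exact congrArg _ (h u v huv.1 huv.2)

section TensorCube

variable {M : Type*} [AddCommGroup M] [Module A M]

/-- `c ⊗ id` on `(M ⊗ M) ⊗ M`. -/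
abbrev onFirstSecond (c : (M ⊗[A] M) →ₗ[A] (M ⊗[A] M)) :
    ((M ⊗[A] M) ⊗[A] M) →ₗ[A] ((M ⊗[A] M) ⊗[A] M) :=
  LinearMap.rTensor M c

/-- `id ⊗ c` on `(M ⊗ M) ⊗ M`. -/
abbrev onSecondThird (c : (M ⊗[A] M) →ₗ[A] (M ⊗[A] M)) :
    ((M ⊗[A] M) ⊗[A] M) →ₗ[A] ((M ⊗[A] M) ⊗[A] M) :=
  (TensorProduct.assoc A M M M).symm.toLinearMap ∘ₗ (LinearMap.lTensor M c) ∘ₗ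
    (TensorProduct.assoc A M M M).toLinearMap

/-- The action of `c` on the first and third factors of `(M ⊗ M) ⊗ M`. -/
abbrev onFirstThird (c : (M ⊗[A] M) →ₗ[A] (M ⊗[A] M)) :
    ((M ⊗[A] M) ⊗[A] M) →ₗ[A] ((M ⊗[A] M) ⊗[A] M) :=
  (TensorProduct.rightComm A M M M).toLinearMap ∘ₗ (LinearMap.rTensor M c) ∘ₗ
    (TensorProduct.rightComm A M M M).toLinearMap

theorem onFirstSecond_comp (c d : (M ⊗[A] M) →ₗ[A] (M ⊗[A] M)) :
    onFirstSecond (c ∘ₗ d) = onFirstSecond c ∘ₗ onFirstSecond d :=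
  LinearMap.rTensor_comp M c d

theorem onSecondThird_comp (c d : (M ⊗[A] M) →ₗ[A] (M ⊗[A] M)) :
    onSecondThird (c ∘ₗ d) = onSecondThird c ∘ₗ onSecondThird d := by
  ext x y z
  simp

theorem onFirstSecond_injective {c d : (M ⊗[A] M) →ₗ[A] (M ⊗[A] M)} (h : d ∘ₗ c = LinearMap.id) :
    Function.Injective (onFirstSecond c) := by
  refine Function.LeftInverse.injective (g := onFirstSecond d) fun t => ?_
  rw [← LinearMap.comp_apply, ← onFirstSecond_comp, h]
  simp

theorem onSecondThird_injective {c d : (M ⊗[A] M) →ₗ[A] (M ⊗[A] M)} (h : d ∘ₗ c = LinearMap.id) :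
    Function.Injective (onSecondThird c) := by
  refine Function.LeftInverse.injective (g := onSecondThird d) fun t => ?_
  rw [← LinearMap.comp_apply, ← onSecondThird_comp, h]
  simp

end TensorCube

section Commutation

variable {R : YBRack Q} {c f : ((Q →₀ A) ⊗[A] (Q →₀ A)) →ₗ[A] ((Q →₀ A) ⊗[A] (Q →₀ A))}

theorem Entropic2.onSecondThird_comp_onFirstSecond (hf : Entropic2 R A f)
    (hc : ∀ x y : Q, c (Finsupp.single x (1 : A) ⊗ₜ[A] Finsupp.single y (1 : A))
      = Finsupp.single y (1 : A) ⊗ₜ[A] Finsupp.single (R.act x y) (1 : A)) :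
    onSecondThird f ∘ₗ onFirstSecond c = onFirstSecond c ∘ₗ onFirstThird f := by
  ext x y z : 8
  have := hf.map_apply_eq
    ((TensorProduct.assoc A (Q →₀ A) (Q →₀ A) (Q →₀ A)).symm.toLinearMap ∘ₗ
      TensorProduct.mk A _ _ (Finsupp.single y (1 : A)))
    (onFirstSecond c ∘ₗ (TensorProduct.rightComm A (Q →₀ A) (Q →₀ A) (Q →₀ A)).toLinearMap ∘ₗ
      (TensorProduct.mk A _ _).flip (Finsupp.single y (1 : A)))
    (R.rho_mem_inn y) R.Inn.one_mem x z (fun u v _ _ => by simp [hc, YBRack.rho])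
  simpa [hc, YBRack.rho] using this

theorem Entropic2.onFirstSecond_comp_onSecondThird (hf : Entropic2 R A f)
    (hc : ∀ x y : Q, c (Finsupp.single x (1 : A) ⊗ₜ[A] Finsupp.single y (1 : A))
      = Finsupp.single y (1 : A) ⊗ₜ[A] Finsupp.single (R.act x y) (1 : A)) :
    onFirstSecond f ∘ₗ onSecondThird c = onSecondThird c ∘ₗ onFirstThird f := by
  ext x y z : 8
  have := hf.map_apply_eq
    ((TensorProduct.mk A _ _).flip (Finsupp.single (R.act y z) (1 : A)))
    (onSecondThird c ∘ₗ (TensorProduct.rightComm A (Q →₀ A) (Q →₀ A) (Q →₀ A)).toLinearMap ∘ₗ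
      (TensorProduct.mk A _ _).flip (Finsupp.single y (1 : A)))
    R.Inn.one_mem R.Inn.one_mem x z (fun u v _ hv => by
      have : R.act y z = R.act y v := congrArg (fun σ : Equiv.Perm Q => σ y) hv
      simp [hc, this])
  simpa [hc] using this

theorem Entropic2.onFirstThird_comp_onFirstSecond (hf : Entropic2 R A f)
    (hc : ∀ x y : Q, c (Finsupp.single x (1 : A) ⊗ₜ[A] Finsupp.single y (1 : A))
      = Finsupp.single y (1 : A) ⊗ₜ[A] Finsupp.single (R.act x y) (1 : A)) :
    onFirstThird f ∘ₗ onFirstSecond c = onFirstSecond c ∘ₗ onSecondThird f := by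
  ext x y z : 8
  have := hf.map_apply_eq
    ((TensorProduct.rightComm A (Q →₀ A) (Q →₀ A) (Q →₀ A)).toLinearMap ∘ₗ
      (TensorProduct.mk A _ _).flip (Finsupp.single (R.act x y) (1 : A)))
    (onFirstSecond c ∘ₗ (TensorProduct.assoc A (Q →₀ A) (Q →₀ A) (Q →₀ A)).symm.toLinearMap ∘ₗ
      TensorProduct.mk A _ _ (Finsupp.single x (1 : A)))
    R.Inn.one_mem R.Inn.one_mem y z (fun u v hu _ => by
      have : R.act x y = R.act x u := congrArg (fun σ : Equiv.Perm Q => σ x) hu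
      simp [hc, this])
  simpa [hc] using this

theorem Entropic2.onFirstThird_comp_onSecondThird (hf : Entropic2 R A f)
    (hc : ∀ x y : Q, c (Finsupp.single x (1 : A) ⊗ₜ[A] Finsupp.single y (1 : A))
      = Finsupp.single y (1 : A) ⊗ₜ[A] Finsupp.single (R.act x y) (1 : A)) :
    onFirstThird f ∘ₗ onSecondThird c = onSecondThird c ∘ₗ onFirstSecond f := by
  ext x y z : 8
  have := hf.map_apply_eq
    ((TensorProduct.rightComm A (Q →₀ A) (Q →₀ A) (Q →₀ A)).toLinearMap ∘ₗ
      (TensorProduct.mk A _ _).flip (Finsupp.single z (1 : A)))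
    (onSecondThird c ∘ₗ (TensorProduct.mk A _ _).flip (Finsupp.single z (1 : A)))
    R.Inn.one_mem (R.rho_mem_inn z) x y (fun u v _ _ => by simp [hc, YBRack.rho])
  simpa [hc, YBRack.rho] using this

theorem YBRack.yangBaxter_braiding
    (hc : ∀ x y : Q, c (Finsupp.single x (1 : A) ⊗ₜ[A] Finsupp.single y (1 : A))
      = Finsupp.single y (1 : A) ⊗ₜ[A] Finsupp.single (R.act x y) (1 : A)) :
    YBE c := by
  unfold YBE
  ext x y z : 8
  simp [hc, R.self_distrib x y z]

/-- For entropic `f`, the Yang–Baxter equation for `c_Q ∘ f` is a condition on `f` alone. -/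
theorem Entropic2.yangBaxter_comp_iff (hf : Entropic2 R A f)
    (hc : ∀ x y : Q, c (Finsupp.single x (1 : A) ⊗ₜ[A] Finsupp.single y (1 : A))
      = Finsupp.single y (1 : A) ⊗ₜ[A] Finsupp.single (R.act x y) (1 : A)) :
    YBE (c ∘ₗ f) ↔ onSecondThird f ∘ₗ onFirstThird f ∘ₗ onFirstSecond f
      = onFirstSecond f ∘ₗ onFirstThird f ∘ₗ onSecondThird f := by
  obtain ⟨d, hd⟩ := R.braiding_hasLeftInverse c hc
  have hYB : onFirstSecond c ∘ₗ onSecondThird c ∘ₗ onFirstSecond c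
      = onSecondThird c ∘ₗ onFirstSecond c ∘ₗ onSecondThird c := YBRack.yangBaxter_braiding hc
  have h₁ := LinearMap.congr_fun (hf.onSecondThird_comp_onFirstSecond hc)
  have h₂ := LinearMap.congr_fun (hf.onFirstSecond_comp_onSecondThird hc)
  have h₃ := LinearMap.congr_fun (hf.onFirstThird_comp_onFirstSecond hc)
  have h₄ := LinearMap.congr_fun (hf.onFirstThird_comp_onSecondThird hc)
  have hY := LinearMap.congr_fun hYB
  have i₁ := onFirstSecond_injective hd
  have i₂ := onSecondThird_injective hd
  change onFirstSecond (c ∘ₗ f) ∘ₗ onSecondThird (c ∘ₗ f) ∘ₗ onFirstSecond (c ∘ₗ f)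
      = onSecondThird (c ∘ₗ f) ∘ₗ onFirstSecond (c ∘ₗ f) ∘ₗ onSecondThird (c ∘ₗ f) ↔ _
  rw [onFirstSecond_comp, onSecondThird_comp]
  generalize onFirstSecond c = c₁₂, onSecondThird c = c₂₃, onFirstSecond f = f₁₂,
    onSecondThird f = f₂₃, onFirstThird f = f₁₃ at *
  simp only [LinearMap.ext_iff, LinearMap.comp_apply] at h₁ h₂ h₃ h₄ hY ⊢
  refine forall_congr' fun t => ?_
  rw [h₁, h₂, h₃, h₂, h₁, h₄, ← hY, i₁.eq_iff, i₂.eq_iff, i₁.eq_iff]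

end Commutation

end Entropic

/-- (Theorem 3, higher obstructions.) For an entropic automorphism
`f` of `AQ ⊗ AQ`, the composite `c_Q ∘ f` satisfies the Yang–Baxter equation iff
`τ ∘ f` does, where `τ` is the transposition operator; that is, iff `f` is an
r-matrix. -/
theorem entropic_deformation_YB_iff_rmatrix
    {A Q : Type*} [CommRing A] (R : YBRack Q)
    (cQ : ((Q →₀ A) ⊗[A] (Q →₀ A)) →ₗ[A] ((Q →₀ A) ⊗[A] (Q →₀ A)))
    (hcQ : ∀ x y : Q,
      cQ (Finsupp.single x (1 : A) ⊗ₜ[A] Finsupp.single y (1 : A))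
        = Finsupp.single y (1 : A) ⊗ₜ[A] Finsupp.single (R.act x y) (1 : A))
    (τ : ((Q →₀ A) ⊗[A] (Q →₀ A)) →ₗ[A] ((Q →₀ A) ⊗[A] (Q →₀ A)))
    (hτ : ∀ x y : Q,
      τ (Finsupp.single x (1 : A) ⊗ₜ[A] Finsupp.single y (1 : A))
        = Finsupp.single y (1 : A) ⊗ₜ[A] Finsupp.single x (1 : A))
    (f : ((Q →₀ A) ⊗[A] (Q →₀ A)) →ₗ[A] ((Q →₀ A) ⊗[A] (Q →₀ A)))
    (hf : Function.Bijective f) (hent : Entropic2 R A f) :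
    YBE (cQ ∘ₗ f) ↔ YBE (τ ∘ₗ f) := by
  have hτ' : ∀ x y : Q, τ (Finsupp.single x (1 : A) ⊗ₜ[A] Finsupp.single y (1 : A))
      = Finsupp.single y (1 : A) ⊗ₜ[A] Finsupp.single ((YBRack.trivial Q).act x y) (1 : A) := hτ
  rw [hent.yangBaxter_comp_iff hcQ, (entropic2_trivial f).yangBaxter_comp_iff hτ']


end
end

section
/- Let Q be a rack and A a commutative ring such that Inn(Q) is finite and the image of its order |Inn(Q)| in A is not a zero divisor. Let n ≥ 1 and let f: AQ^n → AQ^n be an entropic A-linear map. If f = d g for some A-linear map g: AQ^{n−1} → AQ^{n−1}, then f = 0. -/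
open TensorProduct

noncomputable section

namespace YBRack

variable {Q : Type*} {A : Type*} [CommRing A]

/-- Iterated actions by behaviourally equivalent lists agree exactly on equal elements. -/
lemma actList_eq_actList_iff (R : YBRack Q) {l l' : List Q} (h : l.map R.rho = l'.map R.rho)
    (a b : Q) : R.actList a l = R.actList b l' ↔ a = b := by
  induction l generalizing l' a b with
  | nil =>
    obtain rfl : l' = [] := by simpa using h.symm
    rfl
  | cons z l ih =>
    cases l' with
    | nil => simp at h
    | cons z' l' =>
      simp only [List.map_cons, List.cons.injEq] at h
      have hz : R.act b z' = R.act b z := congrArg (fun σ : Equiv.Perm Q => σ b) h.1.symm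
      refine (ih h.2 (R.act a z) (R.act b z')).trans ?_
      rw [hz]
      exact (R.rho z).injective.eq_iff

lemma rho_act (R : YBRack Q) (x z : Q) :
    R.rho (R.rho z x) = R.rho z * R.rho x * (R.rho z)⁻¹ := by
  rw [eq_mul_inv_iff_mul_eq]
  ext a
  exact (R.self_distrib a x z).symm

/-- Inner automorphisms conjugate right translations. -/
lemma rho_inn_apply (R : YBRack Q) {σ : Equiv.Perm Q} (hσ : σ ∈ R.Inn) (x : Q) :
    R.rho (σ x) = σ * R.rho x * σ⁻¹ := by
  induction hσ using Subgroup.closure_induction generalizing x with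
  | mem σ h =>
    obtain ⟨z, rfl⟩ := h
    exact R.rho_act x z
  | one => simp
  | mul σ τ _ _ hσ hτ => rw [Equiv.Perm.mul_apply, hσ, hτ]; group
  | inv σ _ hσ =>
    have h := hσ (σ⁻¹ x)
    rw [← Equiv.Perm.mul_apply, mul_inv_cancel, Equiv.Perm.one_apply] at h
    rw [h]
    group

lemma BEquiv.inn_apply {R : YBRack Q} {x y : Q} (h : R.BEquiv x y) (σ : R.Inn) :
    R.BEquiv ((σ : Equiv.Perm Q) x) ((σ : Equiv.Perm Q) y) := by
  unfold BEquiv at *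
  rw [R.rho_inn_apply σ.2, R.rho_inn_apply σ.2, h]

/-- Right translation by an element, as an inner automorphism. -/
def innRho (R : YBRack Q) (z : Q) : R.Inn :=
  ⟨R.rho z, Subgroup.subset_closure ⟨z, rfl⟩⟩

/-- Multiply the components before the `i`-th one by the translation by the `i`-th element. -/
def shift (R : YBRack Q) {n : ℕ} (i : Fin n) (x : Fin n → Q) (α : Fin n → R.Inn) :
    Fin n → R.Inn :=
  fun j => if j < i then R.innRho ((α i : Equiv.Perm Q) (x i)) * α j else α j

lemma shift_injective (R : YBRack Q) {n : ℕ} (i : Fin n) (x : Fin n → Q) :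
    Function.Injective (R.shift i x) := by
  intro α β h
  have hi : α i = β i := by simpa [shift] using congrFun h i
  funext j
  have hj := congrFun h j
  by_cases hji : j < i <;> simpa [shift, hji, hi] using hj

open scoped Classical in
/-- The `i`-th face of a cochain at translated indices, restricted to the diagonal in the
`i`-th index. -/
def faceTranslate (R : YBRack Q) {n : ℕ} (g : (Fin n → Q) → (Fin n → Q) → A)
    (i : Fin (n + 1)) (x y : Fin (n + 1) → Q) (β : Fin (n + 1) → R.Inn) : A :=
  g (fun j => (β (i.succAbove j) : Equiv.Perm Q) (x (i.succAbove j)))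
    (fun j => (β (i.succAbove j) : Equiv.Perm Q) (y (i.succAbove j))) *
      (if x i = y i then 1 else 0)

/-- On behaviourally equivalent tuples a partial coboundary is a difference of translates. -/
lemma dPart_inn_apply (R : YBRack Q) {n : ℕ} (g : (Fin n → Q) → (Fin n → Q) → A)
    (i : Fin (n + 1)) {x y : Fin (n + 1) → Q} (h : ∀ j, R.BEquiv (x j) (y j))
    (α : Fin (n + 1) → R.Inn) :
    R.dPart g i (fun j => (α j : Equiv.Perm Q) (x j)) (fun j => (α j : Equiv.Perm Q) (y j)) =
      R.faceTranslate g i x y α -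
      R.faceTranslate g i x y (R.shift i x α) := by
  classical
  have hα : ∀ j, R.rho ((α j : Equiv.Perm Q) (x j)) = R.rho ((α j : Equiv.Perm Q) (y j)) :=
    fun j => (h j).inn_apply (α j)
  have hlist := R.actList_eq_actList_iff
    (l := (List.ofFn fun j => (α j : Equiv.Perm Q) (x j)).drop ((i : ℕ) + 1))
    (l' := (List.ofFn fun j => (α j : Equiv.Perm Q) (y j)).drop ((i : ℕ) + 1))
    (by simp only [List.map_drop, List.map_ofFn, Function.comp_def, hα])
    ((α i : Equiv.Perm Q) (x i)) ((α i : Equiv.Perm Q) (y i))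
  have hlt : ∀ j : Fin n, i.succAbove j < i ↔ (j : ℕ) < (i : ℕ) := fun j => by
    rw [Fin.succAbove_lt_iff_castSucc_lt, Fin.lt_def, Fin.val_castSucc]
  have hact : ∀ a, R.act a ((α i : Equiv.Perm Q) (y i)) = R.act a ((α i : Equiv.Perm Q) (x i)) :=
    fun a => congrArg (fun σ : Equiv.Perm Q => σ a) (hα i).symm
  have hshift : ∀ (j : Fin n) (a : Q),
      (if (j : ℕ) < (i : ℕ)
        then R.act ((α (i.succAbove j) : Equiv.Perm Q) a) ((α i : Equiv.Perm Q) (x i))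
        else (α (i.succAbove j) : Equiv.Perm Q) a) =
      (R.shift i x α (i.succAbove j) : Equiv.Perm Q) a := fun j a => by
    simp only [shift, hlt]
    split_ifs <;> rfl
  simp only [dPart, faceTranslate, hlist, hact, hshift, EmbeddingLike.apply_eq_iff_eq]

/-- Coboundaries average to zero over the componentwise action of the inner group. -/
lemma sum_dSum_inn_apply (R : YBRack Q) [Fintype R.Inn] {n : ℕ}
    (g : (Fin n → Q) → (Fin n → Q) → A) {x y : Fin (n + 1) → Q}
    (h : ∀ j, R.BEquiv (x j) (y j)) :
    ∑ α : Fin (n + 1) → R.Inn,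
      R.dSum g (fun j => (α j : Equiv.Perm Q) (x j)) (fun j => (α j : Equiv.Perm Q) (y j)) = 0 := by
  simp only [dSum]
  rw [Finset.sum_comm]
  refine Finset.sum_eq_zero fun i _ => ?_
  rw [← Finset.mul_sum, Finset.sum_congr rfl fun α _ => R.dPart_inn_apply g i h α,
    Finset.sum_sub_distrib,
    (Finite.injective_iff_bijective.mp (R.shift_injective i x)).sum_comp
      (R.faceTranslate g i x y), sub_self, mul_zero]

end YBRack

/-- (Lemma: entropic coboundaries vanish.) If the order of
`Inn(Q)` is not a zero divisor in `A`, then an entropic cochain which is a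
coboundary is zero.  Here `f` is an `(n+1)`-cochain and `g` an `n`-cochain,
covering the paper's cochains in all degrees `n ≥ 1`. -/
theorem entropic_coboundary_vanishes
    {A Q : Type*} [CommRing A] (R : YBRack Q)
    [Fintype R.Inn] (hreg : ∀ a : A, (Fintype.card R.Inn : A) * a = 0 → a = 0)
    {n : ℕ} (f : (Fin (n+1) → Q) → (Fin (n+1) → Q) → A)
    (hqd : R.QuasiDiagonal f) (heq : R.FullyEquivariant f)
    (g : (Fin n → Q) → (Fin n → Q) → A)
    (hfg : ∀ x y, f x y = R.dSum g x y) :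
    ∀ x y, f x y = 0 := by
  intro x y
  by_cases h : ∀ j, R.BEquiv (x j) (y j)
  · have hsum := R.sum_dSum_inn_apply g h
    simp only [← hfg, heq x y, Finset.sum_const, Finset.card_univ, Fintype.card_pi,
      Finset.prod_const, Fintype.card_fin, nsmul_eq_mul, Nat.cast_pow] at hsum
    have hcancel : ∀ (k : ℕ) (a : A), (Fintype.card R.Inn : A) ^ k * a = 0 → a = 0 := by
      intro k
      induction k with
      | zero => simp
      | succ k ih =>
        intro a ha
        exact hreg a (ih _ (by rwa [pow_succ, mul_assoc] at ha))
    exact hcancel _ _ hsum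
  · push Not at h
    exact hqd x y h

end
end
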